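/- Let ε ∈ (0,1) satisfy (1 + δ)(1 - ε)^2 > 1 + δ/2, and fix ρ > 0 with ρδ/2 > 1 + δ. Then there exists a constant C = C(ε) > 0 such that for all sufficiently large N, P(∪_{n ≥ N} (D_n^ε ∩ E_n^ε)^c) ≤ C N^{-(ε ∧ (δ/ρ))}. -/

import Mathlib

open MeasureTheory ProbabilityTheory Filter Set
open scoped ENNReal NNReal

variable {Ω : Type*}

/-- Partial sums of the steps: `S X n = X 0 + ⋯ + X (n-1)` (the walk started at `0`). -/
noncomputable def S (X : ℕ → Ω → ℤ) (n : ℕ) (ω : Ω) : ℤ :=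
  ∑ i ∈ Finset.range n, X i ω

/-- The local time at site `z` up to time `n`: `ξ(z,n) = #{k : 0 < k ≤ n, S_k = z}`. -/
noncomputable def localTime (X : ℕ → Ω → ℤ) (z : ℤ) (n : ℕ) (ω : Ω) : ℕ :=
  ((Finset.Icc 1 n).filter (fun k => S X k ω = z)).card

/-- The maximal local time `ξ(n) = max_{y ∈ ℤ} ξ(y,n)`. -/
noncomputable def maxLocalTime (X : ℕ → Ω → ℤ) (n : ℕ) (ω : Ω) : ℕ :=
  sSup (Set.range fun z : ℤ => localTime X z n ω)

/-- The set of favorite sites at time `n`: `K(n) = {z : ξ(z,n) = ξ(n)}`. -/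
noncomputable def favSites (X : ℕ → Ω → ℤ) (n : ℕ) (ω : Ω) : Set ℤ :=
  {z : ℤ | localTime X z n ω = maxLocalTime X n ω}

/-- The total local time at site `z`: `ξ(z,∞) = #{k > 0 : S_k = z}` (as an extended natural). -/
noncomputable def totalLocalTime (X : ℕ → Ω → ℤ) (z : ℤ) (ω : Ω) : ℕ∞ :=
  {k : ℕ | 0 < k ∧ S X k ω = z}.encard

/-- `X` is a sequence of i.i.d. steps with `P(X_i = 1) = p`, `P(X_i = -1) = q`. -/
def IsAsymmetricSRW [MeasurableSpace Ω] (P : Measure Ω) (X : ℕ → Ω → ℤ) (p q : ℝ) : Prop :=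
  (∀ i, Measurable (X i)) ∧
  iIndepFun X P ∧
  (∀ i, P {ω | X i ω = 1} = ENNReal.ofReal p) ∧
  (∀ i, P {ω | X i ω = -1} = ENNReal.ofReal q)

open scoped Classical in
/-- The pair count `F_{a,b}`: the number of pairs `1 ≤ i < j ≤ ⌊a⌋` with
`j ≤ (i + 2λ log a) ∧ ⌊a⌋`, such that both `S_i` and `S_j` have local time at least
`(1-ε) λ log b` at time `⌊a⌋`, neither `S_i` nor `S_j` occurs strictly between times
`i` and `j`, and `S_i ≠ S_j`.  Here `λ = -1/log(2q)`. -/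
noncomputable def Fcount (q : ℝ) (X : ℕ → Ω → ℤ) (ε : ℝ) (a b : ℝ) (ω : Ω) : ℕ :=
  ∑ i ∈ Finset.Icc 1 ⌊a⌋₊,
    ∑ j ∈ Finset.Icc (i + 1) (min ⌊(i : ℝ) + 2 * (-1 / Real.log (2*q)) * Real.log a⌋₊ ⌊a⌋₊),
      if ((1 - ε) * (-1 / Real.log (2*q)) * Real.log b
            ≤ min (localTime X (S X i ω) ⌊a⌋₊ ω : ℝ) (localTime X (S X j ω) ⌊a⌋₊ ω)
          ∧ (∀ l : ℕ, i < l → l < j → S X l ω ≠ S X i ω ∧ S X l ω ≠ S X j ω)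
          ∧ S X i ω ≠ S X j ω) then 1 else 0

/-- The event `D_n^ε = {(1-ε/2) λ log n ≤ ξ(n) ≤ 2(1+ε/2) λ log n}`. -/
noncomputable def Dset (q : ℝ) (X : ℕ → Ω → ℤ) (ε : ℝ) (n : ℕ) : Set Ω :=
  {ω | (1 - ε/2) * (-1 / Real.log (2*q)) * Real.log n ≤ (maxLocalTime X n ω : ℝ)
        ∧ (maxLocalTime X n ω : ℝ) ≤ 2 * (1 + ε/2) * (-1 / Real.log (2*q)) * Real.log n}

/-- The event `E_n^ε = {F_n = 0}`, i.e. there is no pair of nearby thick points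
before time `n`. -/
noncomputable def Eset (q : ℝ) (X : ℕ → Ω → ℤ) (ε : ℝ) (n : ℕ) : Set Ω :=
  {ω | Fcount q X ε (n : ℝ) (n : ℝ) ω = 0}

theorem step_ae [MeasurableSpace Ω] {P : Measure Ω} [IsProbabilityMeasure P]
    {X : ℕ → Ω → ℤ} {p q : ℝ} (hp0 : 0 ≤ p) (hq0 : 0 ≤ q) (hpq : p + q = 1)
    (hX : IsAsymmetricSRW P X p q) (i : ℕ) : P {ω | ¬ (X i ω = 1 ∨ X i ω = -1)} = 0 := by
  obtain ⟨hm, -, h1, h2⟩ := hX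
  have m1 : MeasurableSet {ω | X i ω = 1} := hm i (measurableSet_singleton 1)
  have m2 : MeasurableSet {ω | X i ω = -1} := hm i (measurableSet_singleton (-1))
  have hu : P ({ω | X i ω = 1} ∪ {ω | X i ω = -1}) = 1 := by
    rw [measure_union _ m2, h1, h2, ← ENNReal.ofReal_add hp0 hq0, hpq, ENNReal.ofReal_one]
    rw [Set.disjoint_left]
    intro ω h h'
    simp only [Set.mem_ofPred_eq] at h h'
    omega
  have := (prob_compl_eq_zero_iff (m1.union m2)).2 hu
  exact this

/-- sigma algebra generated by steps with indices in `T` -/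
@[reducible] def sigT (X : ℕ → Ω → ℤ) (T : Set ℕ) : MeasurableSpace Ω :=
  ⨆ j ∈ T, MeasurableSpace.comap (X j) inferInstance

theorem sigT_meas (X : ℕ → Ω → ℤ) {T : Set ℕ} {j : ℕ} (hj : j ∈ T) :
    Measurable[sigT X T] (X j) := by
  have h : MeasurableSpace.comap (X j) inferInstance ≤ sigT X T :=
    le_iSup₂ (f := fun j (_ : j ∈ T) => MeasurableSpace.comap (X j) inferInstance) j hj
  exact (comap_measurable (X j)).mono h le_rfl

theorem indep_sigT [MeasurableSpace Ω] {P : Measure Ω} {X : ℕ → Ω → ℤ} {p q : ℝ}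
    (hX : IsAsymmetricSRW P X p q) {T U : Set ℕ} (hTU : Disjoint T U)
    {A B : Set Ω} (hA : MeasurableSet[sigT X T] A) (hB : MeasurableSet[sigT X U] B) :
    P (A ∩ B) = P A * P B := by
  have h := indep_iSup_of_disjoint (μ := P) (m := fun j => MeasurableSpace.comap (X j) inferInstance)
    (fun i => (hX.1 i).comap_le) hX.2.1 hTU
  exact (Indep_iff _ _ _).1 h A B hA hB

theorem sigT_le [MeasurableSpace Ω] {X : ℕ → Ω → ℤ} (hm : ∀ i, Measurable (X i)) (T : Set ℕ) :
    sigT X T ≤ ‹MeasurableSpace Ω› := iSup₂_le fun i _ => (hm i).comap_le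

/-- number of visits to `A` of the path with steps `x` started at `z`, times `0..n` -/
def vis (A : Finset ℤ) (x : ℕ → ℤ) (z : ℤ) (n : ℕ) : ℕ :=
  ∑ j ∈ Finset.range (n+1), if z + ∑ l ∈ Finset.range j, x l ∈ A then 1 else 0

theorem vis_succ (A : Finset ℤ) (x : ℕ → ℤ) (z : ℤ) (n : ℕ) :
    vis A x z (n+1) = (if z ∈ A then 1 else 0) + vis A (fun l => x (l+1)) (z + x 0) n := by
  unfold vis
  rw [Finset.sum_range_succ', add_comm]
  congr 1
  · simp
  · refine Finset.sum_congr rfl fun j _ => ?_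
    rw [Finset.sum_range_succ', add_comm (∑ _ ∈ _, _), add_assoc]

theorem vis_zero (A : Finset ℤ) (x : ℕ → ℤ) (z : ℤ) :
    vis A x z 0 = (if z ∈ A then 1 else 0) := by
  unfold vis
  rw [Finset.sum_range_one]
  simp

theorem vis_meas (X : ℕ → Ω → ℤ) (A : Finset ℤ) (i : ℕ) (z : ℤ) (n : ℕ) {T : Set ℕ}
    (hT : ∀ l < n, i + l ∈ T) :
    Measurable[sigT X T] (fun ω => vis A (fun l => X (i+l) ω) z n) := by
  unfold vis
  let _ := sigT X T
  refine Finset.measurable_sum _ fun j hj => ?_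
  have h1 : Measurable (fun ω => z + ∑ l ∈ Finset.range j, X (i+l) ω) := by
    refine measurable_const.add (Finset.measurable_sum _ fun l hl => ?_)
    apply sigT_meas
    apply hT
    simp at hj hl
    omega
  refine Measurable.ite ?_ measurable_const measurable_const
  exact h1 (A.measurableSet)

/-- the tail event -/
def visE (X : ℕ → Ω → ℤ) (A : Finset ℤ) (i : ℕ) (z : ℤ) (n k : ℕ) : Set Ω :=
  {ω | k ≤ vis A (fun l => X (i+l) ω) z n}

theorem visE_meas (X : ℕ → Ω → ℤ) (A : Finset ℤ) (i : ℕ) (z : ℤ) (n k : ℕ) {T : Set ℕ}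
    (hT : ∀ l < n, i + l ∈ T) : MeasurableSet[sigT X T] (visE X A i z n k) := 
  vis_meas X A i z n hT (measurableSet_Ici (a := k))

theorem visE_step [MeasurableSpace Ω] {P : Measure Ω} [IsProbabilityMeasure P]
    {X : ℕ → Ω → ℤ} {p q : ℝ} (hp0 : 0 ≤ p) (hq0 : 0 ≤ q) (hpq : p + q = 1)
    (hX : IsAsymmetricSRW P X p q) (A : Finset ℤ) (i : ℕ) (z : ℤ) (n k : ℕ) :
    P.real (visE X A i z (n+1) (k + if z ∈ A then 1 else 0)) =
      p * P.real (visE X A (i+1) (z+1) n k) + q * P.real (visE X A (i+1) (z-1) n k) := by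
  have key : ∀ ω, ω ∈ visE X A i z (n+1) (k + if z ∈ A then 1 else 0) ↔
      ω ∈ visE X A (i+1) (z + X i ω) n k := by
    intro ω
    simp only [visE, Set.mem_ofPred_eq, vis_succ]
    rw [add_comm k, add_le_add_iff_left]
    simp only [add_zero, add_assoc, add_comm 1]
  set E := visE X A i z (n+1) (k + if z ∈ A then 1 else 0)
  have hE : E =ᵐ[P] (({ω | X i ω = 1} ∩ visE X A (i+1) (z+1) n k) ∪
      ({ω | X i ω = -1} ∩ visE X A (i+1) (z-1) n k) : Set Ω) := by
    have h0 : ∀ᵐ ω ∂P, (X i ω = 1 ∨ X i ω = -1) := by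
      rw [ae_iff]; exact step_ae hp0 hq0 hpq hX i
    refine Filter.eventuallyEq_set.2 ?_
    filter_upwards [h0] with ω hω
    rw [key]
    rcases hω with h | h <;> simp [h, sub_eq_add_neg]
  have hd : Disjoint ({i} : Set ℕ) (Set.Ici (i+1)) := by simp
  have hf : ∀ z', MeasurableSet[sigT X (Set.Ici (i+1))] (visE X A (i+1) z' n k) := 
    fun z' => visE_meas X A (i+1) z' n k (by intro l _; simp)
  have hs : ∀ s : ℤ, MeasurableSet[sigT X {i}] {ω | X i ω = s} := 
    fun s => sigT_meas X (T := {i}) rfl (measurableSet_singleton s)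
  have hle := sigT_le hX.1 
  rw [measureReal_congr hE, measureReal_union]
  · simp only [Measure.real]
    rw [indep_sigT hX hd (hs 1) (hf _), indep_sigT hX hd (hs (-1)) (hf _), hX.2.2.1, hX.2.2.2]
    simp [ENNReal.toReal_mul, ENNReal.toReal_ofReal, hp0, hq0]
  · rw [Set.disjoint_left]
    rintro ω ⟨h, -⟩ ⟨h', -⟩
    simp only [Set.mem_ofPred_eq] at h h'
    omega
  · exact (hle _ _ (hs (-1))).inter (hle _ _ (hf _))

theorem visE_upper [MeasurableSpace Ω] {P : Measure Ω} [IsProbabilityMeasure P]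
    {X : ℕ → Ω → ℤ} {p q : ℝ} (hp0 : 0 ≤ p) (hq0 : 0 ≤ q) (hpq : p + q = 1)
    (hX : IsAsymmetricSRW P X p q) (A : Finset ℤ) (G : ℤ → ℝ) (c Θ : ℝ) (hc : 0 < c)
    (hΘ : 0 ≤ Θ) (hG : ∀ z, 0 ≤ G z) (hGA : ∀ z ∈ A, c ≤ G z)
    (h1 : ∀ z, z ∉ A → p * G (z+1) + q * G (z-1) ≤ G z)
    (h2 : ∀ z ∈ A, p * G (z+1) + q * G (z-1) ≤ Θ * G z) (n : ℕ) :
    ∀ i z k, P.real (visE X A i z n (k+1)) ≤ G z * Θ ^ k / c := by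
  have base : ∀ i n, ∀ z ∈ A, P.real (visE X A i z n (0+1)) ≤ G z * Θ ^ 0 / c := by
    intro i n z hz
    refine measureReal_le_one.trans ?_
    rw [le_div_iff₀ hc]
    simpa using hGA z hz
  induction n with
  | zero =>
    intro i z k
    by_cases hz : z ∈ A ∧ k = 0
    · rw [hz.2]; exact base i 0 z hz.1
    · have : visE X A i z 0 (k+1) = ∅ := by
        ext ω
        simp only [visE, vis_zero, Set.mem_ofPred_eq, Set.mem_empty_iff_false, iff_false]
        split_ifs with h
        · have : k ≠ 0 := fun hk => hz ⟨h, hk⟩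
          omega
        · omega
      rw [this]
      have := hG z
      simp only [measureReal_empty]
      positivity
  | succ n ih =>
    intro i z k
    by_cases hz : z ∈ A
    · rcases k with _ | k
      · exact base i _ z hz
      · have := visE_step hp0 hq0 hpq hX A i z n (k+1)
        rw [if_pos hz] at this
        rw [this]
        calc p * P.real (visE X A (i+1) (z+1) n (k+1)) + q * P.real (visE X A (i+1) (z-1) n (k+1))
            ≤ p * (G (z+1) * Θ ^ k / c) + q * (G (z-1) * Θ ^ k / c) := by
              gcongr <;> apply ih
          _ = (p * G (z+1) + q * G (z-1)) * (Θ ^ k / c) := by ring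
          _ ≤ (Θ * G z) * (Θ ^ k / c) := by
              gcongr; exact h2 z hz
          _ = _ := by ring
    · have := visE_step hp0 hq0 hpq hX A i z n (k+1)
      rw [if_neg hz, add_zero] at this
      rw [this]
      calc p * P.real (visE X A (i+1) (z+1) n (k+1)) + q * P.real (visE X A (i+1) (z-1) n (k+1))
            ≤ p * (G (z+1) * Θ ^ k / c) + q * (G (z-1) * Θ ^ k / c) := by
              gcongr <;> apply ih
          _ = (p * G (z+1) + q * G (z-1)) * (Θ ^ k / c) := by ring
          _ ≤ (G z) * (Θ ^ k / c) := by
              gcongr; exact h1 z hz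
          _ = _ := by ring

theorem visE_lower [MeasurableSpace Ω] {P : Measure Ω} [IsProbabilityMeasure P]
    {X : ℕ → Ω → ℤ} {p q : ℝ} (hp0 : 0 ≤ p) (hq0 : 0 ≤ q) (hpq : p + q = 1)
    (hX : IsAsymmetricSRW P X p q) (A : Finset ℤ) (G H : ℤ → ℝ) (r Θ : ℝ) 
    (hr : 0 ≤ r) (hΘ : 0 ≤ Θ) (hΘ1 : Θ ≤ 1) (hG : ∀ z, 0 ≤ G z) (hGA : ∀ z ∈ A, G z ≤ 1)
    (hGH : ∀ z, G z ≤ H z)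
    (h1 : ∀ z, z ∉ A → p * G (z+1) + q * G (z-1) = G z)
    (h2 : ∀ z ∈ A, p * G (z+1) + q * G (z-1) = Θ * G z) 
    (h3 : ∀ z, p * H (z+1) + q * H (z-1) ≤ r * H z) (n : ℕ) :
    ∀ i z k, G z * Θ ^ k - H z * r ^ n ≤ P.real (visE X A i z n (k+1)) := by
  have hH : ∀ z, 0 ≤ H z := fun z => (hG z).trans (hGH z)
  have base : ∀ i n, ∀ z ∈ A, G z * Θ ^ 0 - H z * r ^ n ≤ P.real (visE X A i z n (0+1)) := by
    intro i n z hz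
    have : visE X A i z n (0+1) = Set.univ := by
      ext ω
      simp only [visE, Set.mem_ofPred_eq, Set.mem_univ, iff_true]
      unfold vis
      rw [Finset.sum_range_succ']
      simp [hz]
    rw [this]
    have h4 := hGA z hz
    have h5 : 0 ≤ H z * r ^ n := mul_nonneg (hH z) (pow_nonneg hr n)
    simp
    linarith
  have base2 : ∀ i z k, G z * Θ ^ k - H z * r ^ 0 ≤ P.real (visE X A i z 0 (k+1)) := by
    intro i z k
    have h4 : G z * Θ ^ k ≤ H z * 1 := 
      mul_le_mul (hGH z) (pow_le_one₀ hΘ hΘ1) (by positivity) (hH z)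
    have : 0 ≤ P.real (visE X A i z 0 (k+1)) := by positivity
    simp at h4 ⊢
    linarith
  induction n with
  | zero => exact base2
  | succ n ih =>
    intro i z k
    by_cases hz : z ∈ A
    · rcases k with _ | k
      · exact base i _ z hz
      · have := visE_step hp0 hq0 hpq hX A i z n (k+1)
        rw [if_pos hz] at this
        rw [this]
        calc _ = (Θ * G z) * Θ ^ k - (r * H z) * r ^ n := by ring
          _ ≤ (p * G (z+1) + q * G (z-1)) * Θ ^ k - (p * H (z+1) + q * H (z-1)) * r ^ n := by
            rw [h2 z hz]
            gcongr; exact h3 z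
          _ = p * (G (z+1) * Θ ^ k - H (z+1) * r ^ n) + q * (G (z-1) * Θ ^ k - H (z-1) * r ^ n) := by ring
          _ ≤ _ := by gcongr <;> apply ih
    · have := visE_step hp0 hq0 hpq hX A i z n (k+1)
      rw [if_neg hz, add_zero] at this
      rw [this]
      calc _ = (G z) * Θ ^ k - (r * H z) * r ^ n := by ring
          _ ≤ (p * G (z+1) + q * G (z-1)) * Θ ^ k - (p * H (z+1) + q * H (z-1)) * r ^ n := by
            rw [h1 z hz]
            gcongr; exact h3 z
          _ = p * (G (z+1) * Θ ^ k - H (z+1) * r ^ n) + q * (G (z-1) * Θ ^ k - H (z-1) * r ^ n) := by ring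
          _ ≤ _ := by gcongr <;> apply ih

theorem harm {p q h : ℝ} (hh : 0 < h) (hpq : p + q = 1) (hph : p * h = q) (z : ℤ) :
    p * h ^ (z+1) + q * h ^ (z-1) = h ^ z := by
  rw [zpow_add_one₀ hh.ne', zpow_sub_one₀ hh.ne']
  field_simp
  rw [← hph] at hpq ⊢
  linear_combination h * hpq

/-- harmonic function for one site -/
noncomputable def G1 (h : ℝ) (z : ℤ) : ℝ := if z ≤ 0 then 1 else h ^ z

theorem G1_harm {p q h : ℝ} (hh : 0 < h) (hpq : p + q = 1) (hph : p * h = q) (z : ℤ) (hz : z ≠ 0) :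
    p * G1 h (z+1) + q * G1 h (z-1) = G1 h z := by
  unfold G1
  rcases lt_or_gt_of_ne hz with h1 | h1
  · rw [if_pos (by omega), if_pos (by omega), if_pos (by omega)]; linarith
  · rw [if_neg (by omega), if_neg (by omega : ¬ z ≤ 0)]
    split_ifs with h2
    · obtain rfl : z = 1 := by omega
      have := harm hh hpq hph 1
      simpa using this
    · exact harm hh hpq hph z

theorem G1_zero {p q h : ℝ} (hph : p * h = q) :
    p * G1 h (0+1) + q * G1 h (0-1) = (2 * q) * G1 h 0 := by
  simp [G1]; linarith

theorem G1_nonneg {h : ℝ} (hh : 0 < h) (z : ℤ) : 0 ≤ G1 h z := by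
  unfold G1; split_ifs <;> positivity

theorem G1_le {a : ℝ} (ha : 0 < a) (ha1 : a ≤ 1) (z : ℤ) : G1 (a^2) z ≤ a ^ z := by
  unfold G1; split_ifs with h
  · exact one_le_zpow_of_nonpos₀ ha ha1 h
  · rw [← zpow_natCast, ← zpow_mul]
    apply zpow_le_zpow_right_of_le_one₀ ha ha1
    push_cast; omega

theorem H_sub {p q a : ℝ} (ha : 0 < a) (hph : p * a^2 = q) (z : ℤ) :
    p * a ^ (z+1) + q * a ^ (z-1) ≤ (2 * p * a) * a ^ z := by
  rw [zpow_add_one₀ ha.ne', zpow_sub_one₀ ha.ne', ← hph]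
  apply le_of_eq
  field_simp
  ring

/-- superharmonic function for two sites `0 < d` -/
noncomputable def G2 (a : ℝ) (d z : ℤ) : ℝ :=
  if z ≤ 0 then 1 else if z ≤ d then (a + (a^2) ^ z) / (1 + a)
    else (a + (a^2) ^ d) / (1 + a) * (a^2) ^ (z - d)

theorem G2_mid {a : ℝ} (ha : 0 < a) {d z : ℤ} (h0 : 0 ≤ z) (h1 : z ≤ d) :
    G2 a d z = (a + (a^2) ^ z) / (1 + a) := by
  unfold G2
  split_ifs with h
  · obtain rfl : z = 0 := by omega
    simp; field_simp; ring
  · rfl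

theorem G2_up {a : ℝ} (ha : 0 < a) {d z : ℤ} (h0 : 0 ≤ d) (h1 : d ≤ z) :
    G2 a d z = (a + (a^2) ^ d) / (1 + a) * (a^2) ^ (z - d) := by
  rcases h1.eq_or_lt with rfl | h
  · rw [G2_mid ha h0 le_rfl]; simp
  · unfold G2; rw [if_neg (by omega), if_neg (by omega)]

theorem G2_nonneg {a : ℝ} (ha : 0 < a) (d z : ℤ) : 0 ≤ G2 a d z := by
  unfold G2; split_ifs <;> positivity

theorem G2_harm {p q a : ℝ} (ha : 0 < a) (hpq : p + q = 1) (hph : p * a^2 = q) {d : ℤ} (hd : 0 < d)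
    (z : ℤ) (hz : z ≠ 0) (hz' : z ≠ d) :
    p * G2 a d (z+1) + q * G2 a d (z-1) = G2 a d z := by
  have hh : 0 < a^2 := by positivity
  rcases lt_or_gt_of_ne hz with h1 | h1
  · unfold G2
    rw [if_pos (by omega), if_pos (by omega), if_pos (by omega)]; linarith
  rcases lt_or_gt_of_ne hz' with h2 | h2
  · rw [G2_mid ha (by omega) (by omega), G2_mid ha (by omega) (by omega),
      G2_mid ha (by omega) (by omega), ← harm hh hpq hph z]
    field_simp
    linear_combination a * hpq
  · rw [G2_up ha (by omega) (by omega), G2_up ha (by omega) (by omega), 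
      G2_up ha (by omega) (by omega), ← harm hh hpq hph (z - d)]
    rw [show z + 1 - d = z - d + 1 by ring, show z - 1 - d = z - d - 1 by ring]
    ring

theorem G2_zero {p q a : ℝ} (ha : 0 < a) (hpq : p + q = 1) (hph : p * a^2 = q) {d : ℤ} (hd : 0 < d) :
    p * G2 a d (0+1) + q * G2 a d (0-1) = (2 * q + a) / (1 + a) * G2 a d 0 := by
  have e : G2 a d (0 - 1) = 1 := by simp [G2]
  have e0 : G2 a d 0 = 1 := by simp [G2]
  rw [G2_mid ha (by omega) (by omega), e, e0]
  field_simp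
  simp
  linear_combination a * hpq + hph

theorem G2_d {p q a : ℝ} (ha : 0 < a) (ha1 : a < 1) (hpq : p + q = 1) (hph : p * a^2 = q)
    (hq : q < 1/2) {d : ℤ} (hd : 0 < d) :
    p * G2 a d (d+1) + q * G2 a d (d-1) ≤ (2 * q + a) / (1 + a) * G2 a d d := by
  rw [G2_up ha (by omega) (by omega), G2_mid ha (by omega : 0 ≤ d - 1) (by omega), 
     G2_mid ha (by omega : 0 ≤ d) le_rfl]
  have hh : 0 < a^2 := by positivity
  have hle : (a^2) ^ d ≤ a^2 := by
    calc (a^2) ^ d ≤ (a^2) ^ (1:ℤ) := zpow_le_zpow_right_of_le_one₀ hh (by nlinarith) (by omega)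
      _ = _ := by simp
  have e : q * (a^2) ^ (d-1) = p * (a^2)^d := by
    rw [zpow_sub_one₀ hh.ne', ← hph]; field_simp
  set y := (a^2)^d
  rw [show d + 1 - d = 1 by ring, zpow_one]
  have e2 : p * ((a + y) / (1 + a) * a ^ 2) + q * ((a + (a^2)^(d-1)) / (1 + a)) =
     (2 * q * a + y) / (1 + a) := by
    field_simp
    linear_combination e + (a + y) * hph + y * hpq
  rw [e2, div_mul_div_comm, div_le_div_iff₀ (by positivity) (by positivity)]
  have : 0 ≤ (1 - 2 * q) * (a^2 - y) := mul_nonneg (by linarith) (by linarith)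
  have h3 : (2 * q * a + y) * (1 + a) ≤ (2 * q + a) * (a + y) := by nlinarith
  have := mul_le_mul_of_nonneg_right h3 (by positivity : (0:ℝ) ≤ 1 + a)
  linarith

theorem G2_ge {a : ℝ} (ha : 0 < a) {d z : ℤ} (h0 : 0 ≤ z) (h1 : z ≤ d) :
    a / (1 + a) ≤ G2 a d z := by
  rw [G2_mid ha h0 h1]
  gcongr
  have : 0 < (a^2)^z := by positivity
  linarith

theorem G2_le {a : ℝ} (ha : 0 < a) (ha1 : a < 1) {d z : ℤ} (h0 : 0 ≤ z) (h1 : z ≤ d) :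
    G2 a d z ≤ 1 := by
  rw [G2_mid ha h0 h1, div_le_one (by positivity)]
  have : (a^2)^z ≤ 1 := zpow_le_one₀ (by positivity) (by nlinarith) h0
  linarith

theorem visE_one [MeasurableSpace Ω] {P : Measure Ω} [IsProbabilityMeasure P]
    {X : ℕ → Ω → ℤ} {p q a : ℝ} (ha : 0 < a) (hp0 : 0 < p) (hpq : p + q = 1) (hph : p * a^2 = q)
    (hX : IsAsymmetricSRW P X p q) (i n k : ℕ) :
    P.real (visE X {0} i 0 n (k+1)) ≤ (2 * q) ^ k := by
  have hq0 : 0 < q := by rw [← hph]; positivity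
  have hh : 0 < a^2 := by positivity
  have := visE_upper hp0.le hq0.le hpq hX {0} (G1 (a^2)) 1 (2*q) one_pos (by positivity)
    (G1_nonneg hh) (by simp [G1]) (fun z hz => (G1_harm hh hpq hph z (by simpa using hz)).le)
    (by intro z hz; simp only [Finset.mem_singleton] at hz; subst hz; exact (G1_zero hph).le) n i 0 k
  simpa [G1] using this

theorem visE_one_lower [MeasurableSpace Ω] {P : Measure Ω} [IsProbabilityMeasure P]
    {X : ℕ → Ω → ℤ} {p q a : ℝ} (ha : 0 < a) (ha1 : a < 1) (hp0 : 0 < p) (hq : q < 1/2)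
    (hpq : p + q = 1) (hph : p * a^2 = q)
    (hX : IsAsymmetricSRW P X p q) (i n k : ℕ) :
    (2 * q) ^ k - (2 * p * a) ^ n ≤ P.real (visE X {0} i 0 n (k+1)) := by
  have hq0 : 0 < q := by rw [← hph]; positivity
  have hh : 0 < a^2 := by positivity
  have := visE_lower hp0.le hq0.le hpq hX {0} (G1 (a^2)) (fun z => a ^ z) (2 * p * a) (2*q) 
    (by positivity) (by positivity) (by linarith)
    (G1_nonneg hh) (by simp [G1]) (G1_le ha ha1.le) 
    (fun z hz => (G1_harm hh hpq hph z (by simpa using hz)))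
    (by intro z hz; simp only [Finset.mem_singleton] at hz; subst hz; exact (G1_zero hph)) 
    (fun z => H_sub ha hph z) n i 0 k
  simpa [G1] using this

theorem visE_two [MeasurableSpace Ω] {P : Measure Ω} [IsProbabilityMeasure P]
    {X : ℕ → Ω → ℤ} {p q a : ℝ} (ha : 0 < a) (ha1 : a < 1) (hp0 : 0 < p) (hq : q < 1/2)
    (hpq : p + q = 1) (hph : p * a^2 = q)
    (hX : IsAsymmetricSRW P X p q) (i n k : ℕ) (d z : ℤ) (hd : 0 < d) (hz : z = 0 ∨ z = d) :
    P.real (visE X {0, d} i z n (k+1)) ≤ ((2 * q + a) / (1 + a)) ^ k / (a / (1 + a)) := by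
  have hq0 : 0 < q := by rw [← hph]; positivity
  have := visE_upper hp0.le hq0.le hpq hX {0, d} (G2 a d) (a / (1+a)) ((2 * q + a) / (1 + a))
    (by positivity) (by positivity)
    (G2_nonneg ha d) 
    (by 
      intro z hz
      simp only [Finset.mem_insert, Finset.mem_singleton] at hz
      exact G2_ge ha (by omega) (by omega)) 
    (fun z hz => by
      simp only [Finset.mem_insert, Finset.mem_singleton, not_or] at hz
      exact (G2_harm ha hpq hph hd z hz.1 hz.2).le)
    (by 
      intro z hz; simp only [Finset.mem_insert, Finset.mem_singleton] at hz
      rcases hz with rfl | rfl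
      · exact (G2_zero ha hpq hph hd).le
      · exact G2_d ha ha1 hpq hph hq hd) n i z k
  refine this.trans ?_
  gcongr
  exact mul_le_of_le_one_left (by positivity) (G2_le ha ha1 (by omega) (by omega))

theorem block_bound [MeasurableSpace Ω] {P : Measure Ω} [IsProbabilityMeasure P]
    {X : ℕ → Ω → ℤ} {p q : ℝ} (hX : IsAsymmetricSRW P X p q) (L k : ℕ) (u : ℝ)
    (hu : ∀ i, u ≤ P.real (visE X {0} i 0 L k)) (K : ℕ) :
    P.real {ω | ∀ b < K, ω ∉ visE X {0} (b * L) 0 L k} ≤ (1 - u) ^ K := by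
  have hu1 : 0 ≤ 1 - u := by
    have := (hu 0).trans measureReal_le_one
    linarith
  induction K with
  | zero => simp
  | succ K ih =>
    have e : {ω | ∀ b < K+1, ω ∉ visE X {0} (b * L) 0 L k} = 
        {ω | ∀ b < K, ω ∉ visE X {0} (b * L) 0 L k} ∩ (visE X {0} (K * L) 0 L k)ᶜ := by
      ext ω
      simp only [Set.mem_ofPred_eq, Set.mem_inter_iff, Set.mem_compl_iff]
      constructor
      · intro h; exact ⟨fun b hb => h b (by omega), h K (by omega)⟩
      · rintro ⟨h1, h2⟩ b hb
        rcases Nat.lt_succ_iff_lt_or_eq.1 hb with h | rfl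
        · exact h1 b h
        · exact h2
    have hm2 : MeasurableSet[sigT X (Set.Ici (K*L))] (visE X {0} (K * L) 0 L k) :=
      visE_meas _ _ _ _ _ _ (by intro l _; simp)
    have hm1 : MeasurableSet[sigT X (Set.Iio (K*L))] {ω | ∀ b < K, ω ∉ visE X {0} (b * L) 0 L k} := by
      have : {ω | ∀ b < K, ω ∉ visE X {0} (b * L) 0 L k} = 
          ⋂ b ∈ Finset.range K, (visE X {0} (b * L) 0 L k)ᶜ := by
        ext ω; simp
      rw [this]
      refine @Finset.measurableSet_biInter _ _ (sigT X (Set.Iio (K*L))) _ _ fun b hb => 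
        @MeasurableSet.compl _ _ (sigT X (Set.Iio (K*L))) (visE_meas _ _ _ _ _ _ ?_)
      intro l hl
      simp only [Finset.mem_range] at hb
      simp only [Set.mem_Iio]
      calc b * L + l < (b+1) * L := by linarith [add_mul b 1 L]
        _ ≤ K * L := Nat.mul_le_mul_right _ hb
    have hd : Disjoint (Set.Iio (K*L)) (Set.Ici (K*L)) := by
      rw [Set.disjoint_left]; intro x hx hx'; simp at hx hx'; omega
    rw [e, Measure.real, indep_sigT hX hd hm1 (@MeasurableSet.compl _ _ (sigT X _) hm2), 
      ENNReal.toReal_mul, pow_succ]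
    refine mul_le_mul ih ?_ (by positivity) (by positivity)
    change P.real _ ≤ _
    rw [probReal_compl_eq_one_sub (sigT_le hX.1 _ _ hm2)]
    linarith [hu (K*L)]

theorem S_add (X : ℕ → Ω → ℤ) (i j : ℕ) (ω : Ω) :
    S X (i+j) ω = S X i ω + ∑ l ∈ Finset.range j, X (i+l) ω := by
  unfold S; rw [Finset.sum_range_add]

theorem count_le (X : ℕ → Ω → ℤ) (ω : Ω) (A : Finset ℤ) (i n : ℕ) (z : ℤ) (T : Finset ℕ)
    (hT : ∀ k ∈ T, i ≤ k ∧ k ≤ n ∧ z + (S X k ω - S X i ω) ∈ A) :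
    T.card ≤ vis A (fun l => X (i+l) ω) z n := by
  unfold vis
  rw [← Finset.card_filter]
  refine Finset.card_le_card_of_injOn (fun k => k - i) ?_ ?_
  · intro k hk
    obtain ⟨h1, h2, h3⟩ := hT k hk
    obtain ⟨j, rfl⟩ := Nat.exists_eq_add_of_le h1
    rw [S_add] at h3
    simp only [Finset.coe_filter, Set.mem_ofPred_eq, Finset.mem_range]
    refine ⟨by omega, ?_⟩
    simpa using h3
  · intro k hk k' hk' h
    have h1 := (hT k hk).1
    have h2 := (hT k' hk').1
    simp only at h
    omega

theorem vis_le (X : ℕ → Ω → ℤ) (ω : Ω) (i L n : ℕ) (h : i + L ≤ n) :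
    vis {0} (fun l => X (i+l) ω) 0 L ≤ localTime X (S X i ω) n ω + 1 := by
  unfold vis localTime
  rw [Finset.sum_range_succ']
  gcongr
  · rw [← Finset.card_filter]
    refine Finset.card_le_card_of_injOn (fun k => i + (k + 1)) ?_ ?_
    · intro k hk
      simp only [Finset.coe_filter, Set.mem_ofPred_eq, Finset.mem_range, zero_add, Finset.mem_singleton] at hk
      simp only [Finset.coe_filter, Set.mem_ofPred_eq, Finset.mem_Icc, S_add, hk.2]
      refine ⟨⟨by omega, by omega⟩, by simp⟩
    · intro k _ k' _ h
      simp only at h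
      omega
  · split_ifs <;> simp

theorem lt_bdd (X : ℕ → Ω → ℤ) (n : ℕ) (ω : Ω) :
    BddAbove (Set.range fun z : ℤ => localTime X z n ω) := by
  refine ⟨n, ?_⟩
  rintro _ ⟨z, rfl⟩
  refine (Finset.card_filter_le _ _).trans ?_
  simp

theorem le_max (X : ℕ → Ω → ℤ) (z : ℤ) (n : ℕ) (ω : Ω) :
    localTime X z n ω ≤ maxLocalTime X n ω := le_csSup (lt_bdd X n ω) ⟨z, rfl⟩

theorem exists_max (X : ℕ → Ω → ℤ) (n : ℕ) (ω : Ω) :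
    ∃ z, localTime X z n ω = maxLocalTime X n ω := by
  have := Nat.sSup_mem (Set.range_nonempty fun z : ℤ => localTime X z n ω) (lt_bdd X n ω)
  exact this

theorem max_upper [MeasurableSpace Ω] {P : Measure Ω} [IsProbabilityMeasure P]
    {X : ℕ → Ω → ℤ} {p q a : ℝ} (ha : 0 < a) (hp0 : 0 < p) (hpq : p + q = 1) (hph : p * a^2 = q)
    (hX : IsAsymmetricSRW P X p q) (n k : ℕ) :
    P.real {ω | k < maxLocalTime X n ω} ≤ n * (2 * q) ^ k := by
  have hsub : {ω | k < maxLocalTime X n ω} ⊆ ⋃ i ∈ Finset.Icc 1 n, visE X {0} i 0 n (k+1) := by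
    intro ω hω
    simp only [Set.mem_ofPred_eq] at hω
    obtain ⟨z, hz⟩ := exists_max X n ω
    rw [← hz] at hω
    unfold localTime at hω
    set T := (Finset.Icc 1 n).filter (fun k => S X k ω = z) with hT
    have hne : T.Nonempty := Finset.card_pos.1 (by omega)
    have hmin := T.min'_mem hne
    simp only [Set.mem_iUnion]
    refine ⟨T.min' hne, (Finset.mem_filter.1 hmin).1, ?_⟩
    have := count_le X ω {0} (T.min' hne) n 0 T (by
      intro k hk
      refine ⟨T.min'_le k hk, ?_, ?_⟩
      · have := (Finset.mem_filter.1 hk).1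
        simp at this; omega
      · rw [(Finset.mem_filter.1 hk).2, (Finset.mem_filter.1 hmin).2]; simp)
    simp only [visE, Set.mem_ofPred_eq]
    omega
  refine (measureReal_mono hsub (measure_ne_top _ _)).trans ((measureReal_biUnion_finset_le _ _).trans ?_)
  refine (Finset.sum_le_sum fun i _ => visE_one ha hp0 hpq hph hX i n k).trans ?_
  simp

theorem max_lower [MeasurableSpace Ω] {P : Measure Ω} [IsProbabilityMeasure P]
    {X : ℕ → Ω → ℤ} {p q a : ℝ} (ha : 0 < a) (ha1 : a < 1) (hp0 : 0 < p) (hq : q < 1/2)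
    (hpq : p + q = 1) (hph : p * a^2 = q)
    (hX : IsAsymmetricSRW P X p q) (n k K L : ℕ) (hKL : K * L ≤ n) :
    P.real {ω | maxLocalTime X n ω < k} ≤ (1 - ((2 * q) ^ k - (2 * p * a) ^ L)) ^ K := by
  refine le_trans (measureReal_mono ?_) (block_bound hX L (k+1) _ 
    (fun i => visE_one_lower ha ha1 hp0 hq hpq hph hX i L k) K)
  intro ω hω b hb hv
  simp only [Set.mem_ofPred_eq, visE] at hω hv
  have h1 := vis_le X ω (b * L) L n (by
    calc b * L + L = (b+1) * L := by ring
      _ ≤ K * L := Nat.mul_le_mul_right _ hb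
      _ ≤ n := hKL)
  have h2 := le_max X (S X (b * L) ω) n ω
  omega

theorem S_lip (X : ℕ → Ω → ℤ) (ω : Ω) (hω : ∀ i, X i ω = 1 ∨ X i ω = -1) (i j : ℕ) :
    |S X (i+j) ω - S X i ω| ≤ j := by
  rw [S_add, add_sub_cancel_left]
  refine (Finset.abs_sum_le_sum_abs _ _).trans ?_
  have : ∀ l ∈ Finset.range j, |X (i+l) ω| ≤ 1 := by
    intro l _
    rcases hω (i+l) with h | h <;> simp [h]
  simpa using Finset.sum_le_sum this

theorem pair_incl (X : ℕ → Ω → ℤ) (ω : Ω) (hω : ∀ i, X i ω = 1 ∨ X i ω = -1) 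
    (n N W m i j : ℕ) (hnN : n ≤ N) (hi : 1 ≤ i) (hij : i < j) (hj : j ≤ i + W) (hjn : j ≤ n) 
    (hne : S X i ω ≠ S X j ω)
    (h1 : m ≤ localTime X (S X i ω) n ω) (h2 : m ≤ localTime X (S X j ω) n ω) :
    ∃ i ∈ Finset.Icc 1 N, ∃ d ∈ Finset.Icc 1 W, 
      ω ∈ visE X {0, (d:ℤ)} i 0 N (2 * m) ∪ visE X {0, (d:ℤ)} i d N (2*m) := by
  set x := S X i ω with hx
  set y := S X j ω with hy
  have hd : |y - x| ≤ W := by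
    obtain ⟨l, rfl⟩ := Nat.exists_eq_add_of_le hij.le
    have := S_lip X ω hω i l
    rw [← hx, ← hy] at this
    have : (l:ℤ) ≤ W := by omega
    omega
  set T := (Finset.Icc 1 n).filter (fun k => S X k ω = x ∨ S X k ω = y) with hT
  have hcard : 2 * m ≤ T.card := by
    have : T = (Finset.Icc 1 n).filter (fun k => S X k ω = x) ∪ 
        (Finset.Icc 1 n).filter (fun k => S X k ω = y) := by
      rw [hT, Finset.filter_or]
    rw [this, Finset.card_union_of_disjoint]
    · unfold localTime at h1 h2; omega
    · rw [Finset.disjoint_left]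
      intro k hk hk'
      exact hne ((Finset.mem_filter.1 hk).2.symm.trans (Finset.mem_filter.1 hk').2)
  have hiT : i ∈ T := by simp [hT, hx]; omega
  have hne : T.Nonempty := ⟨i, hiT⟩
  have hmin := T.min'_mem hne
  set t := T.min' hne with ht
  have hts := (Finset.mem_filter.1 hmin)
  refine ⟨t, ?_, (y - x).natAbs, ?_, ?_⟩
  · have := hts.1
    simp at this ⊢; omega
  · have h5 : ((y - x).natAbs : ℤ) ≤ W := by rw [Int.natCast_natAbs]; exact hd
    simp only [Finset.mem_Icc]; omega
  · have hle : ∀ k ∈ T, t ≤ k ∧ k ≤ N := by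
      intro k hk
      refine ⟨T.min'_le k hk, ?_⟩
      have := (Finset.mem_filter.1 hk).1
      simp at this; omega
    simp only [Set.mem_union, visE, Set.mem_ofPred_eq]
    by_cases hc : S X t ω = min x y
    · left
      refine hcard.trans (count_le X ω _ t N _ T fun k hk => ⟨(hle k hk).1, (hle k hk).2, ?_⟩)
      have := (Finset.mem_filter.1 hk).2
      simp only [Finset.mem_insert, Finset.mem_singleton]
      omega
    · right
      refine hcard.trans (count_le X ω _ t N _ T fun k hk => ⟨(hle k hk).1, (hle k hk).2, ?_⟩)
      have := (Finset.mem_filter.1 hk).2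
      have := hts.2
      simp only [Finset.mem_insert, Finset.mem_singleton]
      omega

theorem E_incl {q : ℝ} (hq0 : 0 < q) (hq : q < 1/2) (X : ℕ → Ω → ℤ) (ω : Ω)
    (hω : ∀ i, X i ω = 1 ∨ X i ω = -1) (ε : ℝ) (hε1 : ε < 1) (M n : ℕ) (hM : 1 ≤ M) (hMn : M ≤ n)
    (hn : n ≤ 2 * M) (hE : ω ∉ Eset q X ε n) :
    ∃ i ∈ Finset.Icc 1 (2*M), ∃ d ∈ Finset.Icc 1 ⌊2 * (-1 / Real.log (2*q)) * Real.log (2*M)⌋₊, 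
      ω ∈ visE X {0, (d:ℤ)} i 0 (2*M) (2 * ⌈(1-ε) * (-1 / Real.log (2*q)) * Real.log M⌉₊) ∪ 
        visE X {0, (d:ℤ)} i d (2*M) (2 * ⌈(1-ε) * (-1 / Real.log (2*q)) * Real.log M⌉₊) := by
  have hlam : 0 < -1 / Real.log (2*q) := 
    div_pos_of_neg_of_neg (by norm_num) (Real.log_neg (by linarith) (by linarith))
  have hM1 : (1:ℝ) ≤ M := by exact_mod_cast hM
  have hMn' : (M:ℝ) ≤ n := by exact_mod_cast hMn
  have hn' : (n:ℝ) ≤ 2 * M := by exact_mod_cast hn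
  have hl1 : Real.log M ≤ Real.log n := Real.log_le_log (by linarith) hMn'
  have hl2 : Real.log n ≤ Real.log (2*M) := Real.log_le_log (by linarith) hn'
  have hl0 : 0 ≤ Real.log n := Real.log_nonneg (by linarith)
  simp only [Eset, Set.mem_ofPred_eq, Fcount, Nat.floor_natCast] at hE
  obtain ⟨i, hi, hE⟩ := Finset.exists_ne_zero_of_sum_ne_zero hE
  obtain ⟨j, hj, hE⟩ := Finset.exists_ne_zero_of_sum_ne_zero hE
  split_ifs at hE with hE'
  swap
  · exact absurd rfl hE
  obtain ⟨h1, -, h3⟩ := hE'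
  rw [Nat.floor_natCast] at h1
  rw [Finset.mem_Icc, le_min_iff] at hj
  rw [Finset.mem_Icc] at hi
  have h1' : ⌈(1-ε) * (-1 / Real.log (2*q)) * Real.log M⌉₊ ≤ 
      min (localTime X (S X i ω) n ω) (localTime X (S X j ω) n ω) := by
    apply Nat.ceil_le.2
    rw [Nat.cast_min]
    refine le_trans ?_ h1
    have : 0 ≤ 1 - ε := by linarith
    gcongr
  refine pair_incl X ω hω n (2*M) _ _ i j hn hi.1 (by omega) ?_ hj.2.2 h3
    (h1'.trans (min_le_left _ _)) (h1'.trans (min_le_right _ _))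
  refine hj.2.1.trans ?_
  rw [add_comm (i:ℝ), Nat.floor_add_natCast (by positivity), add_comm]
  gcongr

theorem E_bound [MeasurableSpace Ω] {P : Measure Ω} [IsProbabilityMeasure P]
    {X : ℕ → Ω → ℤ} {p q a : ℝ} (ha : 0 < a) (ha1 : a < 1) (hp0 : 0 < p) (hq : q < 1/2)
    (hpq : p + q = 1) (hph : p * a^2 = q)
    (hX : IsAsymmetricSRW P X p q) (N W k : ℕ) :
    P.real (⋃ i ∈ Finset.Icc 1 N, ⋃ d ∈ Finset.Icc 1 W, 
      (visE X {0, (d:ℤ)} i 0 N (k+1) ∪ visE X {0, (d:ℤ)} i d N (k+1))) 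
      ≤ N * (W * (2 * (((2 * q + a) / (1 + a)) ^ k / (a / (1 + a))))) := by
  refine (measureReal_biUnion_finset_le _ _).trans ?_
  refine (Finset.sum_le_card_nsmul _ _ (W * (2 * (((2 * q + a) / (1 + a)) ^ k / (a / (1 + a))))) 
    fun i hi => ?_).trans (by simp)
  refine (measureReal_biUnion_finset_le _ _).trans ?_
  refine (Finset.sum_le_card_nsmul _ _ (2 * (((2 * q + a) / (1 + a)) ^ k / (a / (1 + a))))
    fun d hd => ?_).trans (by simp)
  have hd' : 0 < (d:ℤ) := by simp at hd; omega
  refine (measureReal_union_le _ _).trans ?_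
  have h1 := visE_two ha ha1 hp0 hq hpq hph hX i N k d 0 hd' (Or.inl rfl)
  have h2 := visE_two ha ha1 hp0 hq hpq hph hX i N k d d hd' (Or.inr rfl)
  linarith

theorem pow_lam {q : ℝ} (hq0 : 0 < q) (hq : q < 1/2) (c x : ℝ) (hx : 0 < x) :
    (2 * q) ^ (c * (-1 / Real.log (2*q)) * Real.log x) = x ^ (-c) := by
  have hl : Real.log (2*q) ≠ 0 := (Real.log_neg (by linarith) (by linarith)).ne
  rw [Real.rpow_def_of_pos (by linarith), Real.rpow_def_of_pos hx]
  congr 1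
  field_simp

theorem D_upper [MeasurableSpace Ω] {P : Measure Ω} [IsProbabilityMeasure P]
    {X : ℕ → Ω → ℤ} {p q a : ℝ} (ha : 0 < a) (hp0 : 0 < p) (hq0 : 0 < q) (hq : q < 1/2) 
    (hpq : p + q = 1) (hph : p * a^2 = q)
    (hX : IsAsymmetricSRW P X p q) (ε : ℝ) (hε : 0 < ε) (n : ℕ) (hn : 1 ≤ n) :
    P.real {ω | 2 * (1 + ε/2) * (-1 / Real.log (2*q)) * Real.log n < (maxLocalTime X n ω : ℝ)} ≤
      1 / (2 * q) * (n:ℝ) ^ (-(1 + ε)) := by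
  have hlam : 0 < -1 / Real.log (2*q) := 
    div_pos_of_neg_of_neg (by norm_num) (Real.log_neg (by linarith) (by linarith))
  have hn1 : (1:ℝ) ≤ n := by exact_mod_cast hn
  have hn0 : (0:ℝ) < n := by linarith
  have hl0 : 0 ≤ Real.log n := Real.log_nonneg hn1
  set x := 2 * (1 + ε/2) * (-1 / Real.log (2*q)) * Real.log n with hx
  have hx0 : 0 ≤ x := by positivity
  have hs : {ω | x < (maxLocalTime X n ω : ℝ)} ⊆ {ω | ⌊x⌋₊ < maxLocalTime X n ω} := by
    intro ω hω
    exact (Nat.floor_lt hx0).2 hω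
  refine (measureReal_mono hs).trans ((max_upper ha hp0 hpq hph hX n _).trans ?_)
  have h1 : (2 * q) ^ ⌊x⌋₊ ≤ (2*q) ^ (x - 1) := by
    rw [← Real.rpow_natCast]
    exact Real.rpow_le_rpow_of_exponent_ge (by linarith) (by linarith) (Nat.sub_one_lt_floor x).le
  calc (n:ℝ) * (2 * q) ^ ⌊x⌋₊ ≤ n * (2*q) ^ (x - 1) := by gcongr
    _ = n * ((n:ℝ) ^ (-(2 * (1 + ε/2))) / (2 * q)) := by
      rw [Real.rpow_sub_one (by linarith), hx, pow_lam hq0 hq _ _ hn0]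
    _ = 1 / (2*q) * ((n:ℝ) ^ (1:ℝ) * (n:ℝ) ^ (-(2 * (1 + ε/2)))) := by rw [Real.rpow_one]; ring
    _ = _ := by
      rw [← Real.rpow_add hn0]; congr 2; ring

theorem D_lower [MeasurableSpace Ω] {P : Measure Ω} [IsProbabilityMeasure P]
    {X : ℕ → Ω → ℤ} {p q a : ℝ} (ha : 0 < a) (ha1 : a < 1) (hp0 : 0 < p) (hq0 : 0 < q) (hq : q < 1/2) 
    (hpq : p + q = 1) (hph : p * a^2 = q)
    (hX : IsAsymmetricSRW P X p q) (ε : ℝ) (hε : 0 < ε) (hε1 : ε < 1) :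
    ∃ n₀ : ℕ, ∀ n : ℕ, n₀ ≤ n → 
    P.real {ω | (maxLocalTime X n ω : ℝ) < (1 - ε/2) * (-1 / Real.log (2*q)) * Real.log n} ≤
      (n:ℝ) ^ (-(1 + ε)) := by
  have hr0 : 0 < 2 * p * a := by positivity
  have hr1 : 2 * p * a < 1 := by nlinarith [mul_pos hp0 (mul_pos (sub_pos.2 ha1) (sub_pos.2 ha1))]
  have hlr := Real.log_neg hr0 hr1
  set A := -1 / Real.log (2 * p * a) with hA
  have hA0 : 0 < A := div_pos_of_neg_of_neg (by norm_num) hlr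
  have hlam : 0 < -1 / Real.log (2*q) := 
    div_pos_of_neg_of_neg (by norm_num) (Real.log_neg (by linarith) (by linarith))
  -- asymptotics
  have hc0 : 0 < Real.sqrt (q / (3 * (A + 1))) := Real.sqrt_pos.2 (by positivity)
  have ev := (isLittleO_log_rpow_atTop (show 0 < ε/4 by linarith)).bound hc0
  have ev2 := (tendsto_natCast_atTop_atTop (R := ℝ)).eventually 
    (ev.and (Filter.eventually_ge_atTop (Real.exp 1)))
  obtain ⟨n₀, hn₀⟩ := Filter.eventually_atTop.1 ev2
  refine ⟨n₀, fun n hn => ?_⟩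
  obtain ⟨e1, e2⟩ := hn₀ n hn
  have hn1 : (1:ℝ) ≤ n := le_trans (by linarith [Real.add_one_le_exp (1:ℝ)]) e2
  have hn0 : (0:ℝ) < n := by linarith
  have hl1 : 1 ≤ Real.log n := (Real.le_log_iff_exp_le hn0).2 e2
  have e3 : 3 * (A + 1) * (Real.log n)^2 ≤ q * (n:ℝ) ^ (ε/2) := by
    rw [Real.norm_of_nonneg (by linarith), Real.norm_of_nonneg (by positivity)] at e1
    have := pow_le_pow_left₀ (by linarith) e1 2
    rw [mul_pow, Real.sq_sqrt (by positivity), ← Real.rpow_mul_natCast hn0.le] at this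
    rw [show ε / 4 * (2:ℕ) = ε / 2 by push_cast; ring] at this
    calc _ ≤ 3 * (A + 1) * (q / (3 * (A + 1)) * (n:ℝ) ^ (ε/2)) := by gcongr
      _ = _ := by field_simp
  set y := (1 - ε/2) * (-1 / Real.log (2*q)) * Real.log n with hy
  have hy0 : 0 ≤ y := by
    have : 0 < 1 - ε/2 := by linarith
    positivity
  set L := ⌈A * Real.log n⌉₊ with hL
  have hLA : A * Real.log n ≤ L := Nat.le_ceil _
  have hLA2 : (L:ℝ) ≤ (A + 1) * Real.log n := by
    have := (Nat.ceil_lt_add_one (show 0 ≤ A * Real.log n by positivity)).le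
    rw [← hL] at this
    linarith
  have hL0 : (0:ℝ) < L := lt_of_lt_of_le (by positivity) hLA
  set K := n / L with hK
  have hs : {ω | (maxLocalTime X n ω : ℝ) < y} ⊆ {ω | maxLocalTime X n ω < ⌈y⌉₊} := by
    intro ω hω
    exact Nat.lt_ceil.2 hω
  refine (measureReal_mono hs).trans ((max_lower ha ha1 hp0 hq hpq hph hX n _ K L 
    (Nat.div_mul_le_self n L)).trans ?_)
  have h1 : 2 * q * (n:ℝ) ^ (-(1 - ε/2)) ≤ (2 * q) ^ ⌈y⌉₊ := by
    rw [← Real.rpow_natCast]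
    calc 2 * q * (n:ℝ) ^ (-(1 - ε/2)) = (2*q) ^ (y + 1) := by
          rw [Real.rpow_add_one (by linarith), hy, pow_lam hq0 hq _ _ hn0]; ring
      _ ≤ _ := Real.rpow_le_rpow_of_exponent_ge (by linarith) (by linarith) 
          (Nat.ceil_lt_add_one hy0).le
  have h2 : (2 * p * a) ^ L ≤ (n:ℝ) ^ (-1:ℝ) := by
    rw [← Real.rpow_natCast]
    calc _ ≤ (2 * p * a) ^ (A * Real.log n) := 
          Real.rpow_le_rpow_of_exponent_ge hr0 hr1.le hLA
      _ = _ := by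
          rw [Real.rpow_def_of_pos hr0, Real.rpow_def_of_pos hn0]
          congr 1
          rw [hA]; have := hlr.ne; field_simp
  have h3 : (n:ℝ) ^ (-(1 - ε/2)) = (n:ℝ) ^ (ε/2) * (n:ℝ) ^ (-1:ℝ) := by
    rw [← Real.rpow_add hn0]; congr 1; ring
  have h4 : 1 ≤ q * (n:ℝ) ^ (ε/2) := by
    refine le_trans ?_ e3
    nlinarith [one_le_pow₀ hl1 (n := 2)]
  have hni : (n:ℝ) ^ (-1:ℝ) = (n:ℝ)⁻¹ := Real.rpow_neg_one _
  rw [hni] at h2 h3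
  set B := (n:ℝ) ^ (ε/2) with hB
  have hB0 : 0 < B := by positivity
  have h5 : q * B / n ≤ (2 * q) ^ ⌈y⌉₊ - (2 * p * a) ^ L := by
    rw [h3] at h1
    have : 1 * (n:ℝ)⁻¹ ≤ q * B * (n:ℝ)⁻¹ := by gcongr
    rw [div_eq_mul_inv]
    linarith
  have hu1 : (2 * q) ^ ⌈y⌉₊ - (2 * p * a) ^ L ≤ 1 := by
    have : (2 * q) ^ ⌈y⌉₊ ≤ 1 := pow_le_one₀ (by linarith) (by linarith)
    have : 0 ≤ (2 * p * a) ^ L := by positivity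
    linarith
  have hKl : (n:ℝ) / L - 1 ≤ K := by
    have h : n < (K + 1) * L := by
      exact Nat.lt_mul_of_div_lt (Nat.lt_succ_self _) (by exact_mod_cast hL0)
    have h' : (n:ℝ) < (K + 1) * L := by exact_mod_cast h
    have := (div_lt_iff₀ hL0).2 h'
    linarith
  have h6 : 2 * Real.log n ≤ K * (q * B / n) := by
    have hB1 : q * B ≤ n := by
      have : B ≤ (n:ℝ) ^ (1:ℝ) := Real.rpow_le_rpow_of_exponent_le hn1 (by linarith)
      rw [Real.rpow_one] at this
      nlinarith
    calc 2 * Real.log n ≤ q * B / L - 1 := by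
          have : (2 * Real.log n + 1) * L ≤ q * B := by
            refine le_trans ?_ e3
            calc _ ≤ (3 * Real.log n) * ((A + 1) * Real.log n) := by gcongr; linarith
              _ = _ := by ring
          have := (le_div_iff₀ hL0).2 this
          linarith
      _ ≤ q * B / L - q * B / n := by
          have : q * B / n ≤ 1 := (div_le_one hn0).2 hB1
          linarith
      _ = (n / L - 1) * (q * B / n) := by field_simp
      _ ≤ _ := by gcongr
  calc _ ≤ (1 - q * B / n) ^ K := by gcongr
    _ ≤ (Real.exp (-(q * B / n))) ^ K := by
        gcongr
        · linarith
        · linarith [Real.add_one_le_exp (-(q * B / n))]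
    _ = Real.exp (-(K * (q * B / n))) := by rw [← Real.exp_nat_mul]; congr 1; ring
    _ ≤ Real.exp (-(2 * Real.log n)) := by gcongr
    _ = (n:ℝ) ^ (-2:ℝ) := by rw [Real.rpow_def_of_pos hn0]; congr 1; ring
    _ ≤ _ := Real.rpow_le_rpow_of_exponent_le hn1 (by linarith)

theorem D_level [MeasurableSpace Ω] {P : Measure Ω} [IsProbabilityMeasure P]
    {X : ℕ → Ω → ℤ} {p q a : ℝ} (ha : 0 < a) (ha1 : a < 1) (hp0 : 0 < p) (hq0 : 0 < q) (hq : q < 1/2) 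
    (hpq : p + q = 1) (hph : p * a^2 = q)
    (hX : IsAsymmetricSRW P X p q) (ε : ℝ) (hε : 0 < ε) (hε1 : ε < 1) :
    ∃ n₀ : ℕ, ∀ M : ℕ, n₀ ≤ M → 
    P.real (⋃ n ∈ Finset.Ico M (2*M), (Dset q X ε n)ᶜ) ≤ (1 + 1 / (2 * q)) * (M:ℝ) ^ (-ε) := by
  obtain ⟨n₀, hn₀⟩ := D_lower ha ha1 hp0 hq0 hq hpq hph hX ε hε hε1
  refine ⟨max n₀ 1, fun M hM => ?_⟩
  have hM0 : (0:ℝ) < M := by 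
    have : 1 ≤ M := (le_max_right n₀ 1).trans hM
    exact_mod_cast this
  refine (measureReal_biUnion_finset_le _ _).trans ?_
  refine (Finset.sum_le_card_nsmul _ _ ((1 + 1 / (2 * q)) * (M:ℝ) ^ (-(1 + ε))) fun n hn => ?_).trans ?_
  · rw [Finset.mem_Ico] at hn
    have hn1 : max n₀ 1 ≤ n := hM.trans hn.1
    have hMn : (M:ℝ) ≤ n := by exact_mod_cast hn.1
    have hs : (Dset q X ε n)ᶜ ⊆ {ω | (maxLocalTime X n ω : ℝ) < (1 - ε/2) * (-1 / Real.log (2*q)) * Real.log n} ∪ 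
      {ω | 2 * (1 + ε/2) * (-1 / Real.log (2*q)) * Real.log n < (maxLocalTime X n ω : ℝ)} := by
      intro ω hω
      simp only [Dset, Set.mem_compl_iff, Set.mem_ofPred_eq, not_and_or, not_le] at hω
      exact hω
    refine (measureReal_mono hs).trans ((measureReal_union_le _ _).trans ?_)
    have h1 := hn₀ n ((le_max_left _ _).trans hn1)
    have h2 := D_upper ha hp0 hq0 hq hpq hph hX ε hε n ((le_max_right _ _).trans hn1)
    have h3 : (n:ℝ) ^ (-(1+ε)) ≤ (M:ℝ) ^ (-(1+ε)) := 
      Real.rpow_le_rpow_of_nonpos hM0 hMn (by linarith)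
    calc _ ≤ (1 + 1 / (2 * q)) * (n:ℝ) ^ (-(1 + ε)) := by linarith
      _ ≤ _ := by gcongr
  · simp only [Nat.card_Ico, nsmul_eq_mul]
    rw [show 2 * M - M = M by omega]
    apply le_of_eq
    calc _ = (1 + 1 / (2 * q)) * ((M:ℝ)^(1:ℝ) * (M:ℝ) ^ (-(1 + ε))) := by rw [Real.rpow_one]; ring
      _ = _ := by rw [← Real.rpow_add hM0]; congr 2; ring

theorem E_level [MeasurableSpace Ω] {P : Measure Ω} [IsProbabilityMeasure P]
    {X : ℕ → Ω → ℤ} {p q a δ : ℝ} (ha : 0 < a) (ha1 : a < 1) (hp0 : 0 < p) (hq0 : 0 < q) (hq : q < 1/2) 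
    (hpq : p + q = 1) (hph : p * a^2 = q)
    (hX : IsAsymmetricSRW P X p q) 
    (hδ : δ = 2 * Real.log ((2*q + a) / (1 + a)) / Real.log (2*q) - 1)
    (ε : ℝ) (hε1 : ε < 1) (hη : 1 + δ/2 < (1 + δ) * (1 - ε)) :
    ∃ C : ℝ, 0 < C ∧ ∀ M : ℕ, 2 ≤ M → 
    P.real (⋃ n ∈ Finset.Ico M (2*M), (Eset q X ε n)ᶜ) ≤ C * (M:ℝ) ^ (-(δ/2)) := by
  have hlq := (Real.log_neg (by linarith : 0 < 2 * q) (by linarith))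
  have hlam : 0 < -1 / Real.log (2*q) := div_pos_of_neg_of_neg (by norm_num) hlq
  set lam := -1 / Real.log (2*q) with hlamdef
  set θ := (2*q + a) / (1 + a) with hθ
  have hθ0 : 0 < θ := by positivity
  have hθ1 : θ < 1 := by rw [hθ, div_lt_one (by positivity)]; linarith
  set η := (1 + δ) * (1 - ε) - (1 + δ/2) with hηd
  have hη0 : 0 < η := by linarith
  refine ⟨2 * (2 * lam * (2 ^ η / η)) * (2 * (θ⁻¹ / (a / (1 + a)))), by positivity, fun M hM => ?_⟩
  have hM2 : (2:ℝ) ≤ M := by exact_mod_cast hM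
  have hM0 : (0:ℝ) < M := by linarith
  have hlM : 0 < Real.log M := Real.log_pos (by linarith)
  have hlM2 : 0 < Real.log (2 * M) := Real.log_pos (by linarith)
  set y := (1-ε) * lam * Real.log M with hy
  have hy0 : 0 < y := by
    have : 0 < 1 - ε := by linarith
    positivity
  set W := ⌊2 * lam * Real.log (2*M)⌋₊ with hW
  set m := ⌈y⌉₊ with hm
  have hm0 : 0 < m := Nat.ceil_pos.2 hy0
  obtain ⟨k, hk⟩ : ∃ k, 2 * m = k + 1 := ⟨2 * m - 1, by omega⟩
  have hnull : P {ω | ¬ ∀ i, (X i ω = 1 ∨ X i ω = -1)} = 0 := by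
    rw [← ae_iff, ae_all_iff]
    intro i
    rw [ae_iff]
    exact step_ae hp0.le hq0.le hpq hX i
  have hs : (⋃ n ∈ Finset.Ico M (2*M), (Eset q X ε n)ᶜ) ⊆ 
      (⋃ i ∈ Finset.Icc 1 (2*M), ⋃ d ∈ Finset.Icc 1 W, 
      (visE X {0, (d:ℤ)} i 0 (2*M) (k+1) ∪ visE X {0, (d:ℤ)} i d (2*M) (k+1))) ∪ 
      {ω | ¬ ∀ i, (X i ω = 1 ∨ X i ω = -1)} := by
    intro ω hω
    by_cases hg : ∀ i, (X i ω = 1 ∨ X i ω = -1)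
    · left
      simp only [Set.mem_iUnion] at hω
      obtain ⟨n, hn, hE⟩ := hω
      rw [Finset.mem_Ico] at hn
      obtain ⟨i, hi, d, hd, h⟩ := E_incl hq0 hq X ω hg ε hε1 M n (by omega) hn.1 hn.2.le hE
      rw [← hk]
      simp only [Set.mem_iUnion]
      exact ⟨i, hi, d, hd, h⟩
    · right; exact hg
  refine (measureReal_mono hs (measure_ne_top _ _)).trans ((measureReal_union_le _ _).trans ?_)
  have hnr : P.real {ω | ¬ ∀ i, (X i ω = 1 ∨ X i ω = -1)} = 0 := by simp only [Measure.real, hnull]; rfl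
  rw [hnr, add_zero]
  refine (E_bound ha ha1 hp0 hq hpq hph hX (2*M) W k).trans ?_
  rw [← hθ]
  have h1 : θ ^ k ≤ θ⁻¹ * (M:ℝ) ^ (-((1 + δ) * (1 - ε))) := by
    rw [← Real.rpow_natCast]
    calc θ ^ (k:ℝ) ≤ θ ^ (2 * y - 1) := by
          apply Real.rpow_le_rpow_of_exponent_ge hθ0 hθ1.le
          have : (2:ℝ) * m = k + 1 := by exact_mod_cast hk
          have : y ≤ m := Nat.le_ceil y
          linarith
      _ = _ := by
          rw [Real.rpow_sub_one hθ0.ne', div_eq_inv_mul]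
          congr 1
          rw [Real.rpow_def_of_pos hθ0, Real.rpow_def_of_pos hM0, hδ, hy, hlamdef]
          congr 1
          have := hlq.ne
          field_simp
          ring
  have h2 : (W:ℝ) ≤ 2 * lam * (2 ^ η / η * (M:ℝ) ^ η) := by
    calc (W:ℝ) ≤ 2 * lam * Real.log (2*M) := Nat.floor_le (by positivity)
      _ ≤ 2 * lam * ((2 * (M:ℝ)) ^ η / η) := by
          gcongr; exact Real.log_le_rpow_div (by positivity) hη0
      _ = _ := by rw [Real.mul_rpow (by norm_num) hM0.le]; ring
  calc ((2 * M : ℕ):ℝ) * (W * (2 * (θ ^ k / (a / (1 + a))))) 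
      ≤ (2 * M) * ((2 * lam * (2 ^ η / η * (M:ℝ) ^ η)) * 
        (2 * ((θ⁻¹ * (M:ℝ) ^ (-((1 + δ) * (1 - ε)))) / (a / (1 + a))))) := by
        push_cast
        gcongr
    _ = 2 * (2 * lam * (2 ^ η / η)) * (2 * (θ⁻¹ / (a / (1 + a)))) * 
      ((M:ℝ)^(1:ℝ) * (M:ℝ) ^ η * (M:ℝ) ^ (-((1 + δ) * (1 - ε)))) := by rw [Real.rpow_one]; ring
    _ = _ := by
      rw [← Real.rpow_add hM0, ← Real.rpow_add hM0]
      congr 2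
      rw [hηd]; ring

theorem dyadic_sum [MeasurableSpace Ω] {P : Measure Ω} (B : ℕ → Set Ω) (C s : ℝ) (hC : 0 < C)
    (hs : 0 < s) (N : ℕ) (hN : 1 ≤ N) 
    (h : ∀ M, N ≤ M → P (⋃ n ∈ Finset.Ico M (2*M), B n) ≤ ENNReal.ofReal (C * (M:ℝ) ^ (-s))) :
    P (⋃ n ∈ {n : ℕ | N ≤ n}, B n) ≤ ENNReal.ofReal (C * (1 - 2 ^ (-s))⁻¹ * (N:ℝ) ^ (-s)) := by
  have hsub : (⋃ n ∈ {n : ℕ | N ≤ n}, B n) ⊆ 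
      ⋃ j : ℕ, ⋃ n ∈ Finset.Ico (2^j * N) (2 * (2^j*N)), B n := by
    intro ω hω
    simp only [Set.mem_iUnion, Set.mem_ofPred_eq] at hω ⊢
    obtain ⟨n, hn, hω⟩ := hω
    refine ⟨Nat.log 2 (n / N), n, ?_, hω⟩
    have h0 : n / N ≠ 0 := (Nat.div_pos hn hN).ne'
    have h1 := Nat.pow_log_le_self 2 h0
    have h2 := Nat.lt_pow_succ_log_self (b := 2) (by norm_num) (n / N)
    rw [Finset.mem_Ico]
    refine ⟨(Nat.le_div_iff_mul_le hN).1 h1, ?_⟩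
    have := (Nat.div_lt_iff_lt_mul hN).1 h2
    rw [Nat.succ_eq_add_one, pow_succ] at this
    linarith
  have ht1 : (2:ℝ) ^ (-s) < 1 := Real.rpow_lt_one_of_one_lt_of_neg (by norm_num) (by linarith)
  have ht0 : (0:ℝ) < 2 ^ (-s) := by positivity
  have hsum := (hasSum_geometric_of_lt_one ht0.le ht1).mul_left (C * (N:ℝ) ^ (-s))
  refine (measure_mono hsub).trans ((measure_iUnion_le _).trans ?_)
  calc _ ≤ ∑' j : ℕ, ENNReal.ofReal (C * (N:ℝ) ^ (-s) * (2 ^ (-s)) ^ j) := by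
        refine ENNReal.tsum_le_tsum fun j => ?_
        refine (h (2^j * N) (Nat.le_mul_of_pos_left _ (by positivity))).trans ?_
        apply ENNReal.ofReal_le_ofReal
        apply le_of_eq
        push_cast
        rw [Real.mul_rpow (by positivity) (by positivity), ← Real.rpow_natCast, ← Real.rpow_natCast,
          ← Real.rpow_mul (by norm_num), ← Real.rpow_mul (by norm_num), mul_comm (j:ℝ)]
        ring
    _ = ENNReal.ofReal (∑' j : ℕ, (C * (N:ℝ) ^ (-s) * (2 ^ (-s)) ^ j)) := by
        rw [ENNReal.ofReal_tsum_of_nonneg _ hsum.summable]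
        intro j; positivity
    _ ≤ _ := by
        rw [hsum.tsum_eq]
        apply ENNReal.ofReal_le_ofReal
        apply le_of_eq; ring

/-- For `ε ∈ (0,1)` with `(1+δ)(1-ε)² > 1+δ/2` and `ρ > 0` with `ρδ/2 > 1+δ`,
there is `C > 0` such that for all large `N`,
`P(∪_{n ≥ N} (D_n^ε ∩ E_n^ε)ᶜ) ≤ C N^{-(ε ∧ (δ/ρ))}`. -/
theorem prob_bad_event_union
    [MeasurableSpace Ω] (P : Measure Ω) [IsProbabilityMeasure P]
    (X : ℕ → Ω → ℤ) (p q : ℝ) (hq0 : 0 < q) (hq : q < 1/2) (hpq : p + q = 1)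
    (hX : IsAsymmetricSRW P X p q)
    (δ : ℝ)
    (hδ : δ = 2 * Real.log ((2*q + Real.sqrt (q/p)) / (1 + Real.sqrt (q/p))) / Real.log (2*q) - 1)
    (ε : ℝ) (hε : ε ∈ Set.Ioo (0:ℝ) 1) (hε2 : (1 + δ) * (1 - ε)^2 > 1 + δ/2)
    (ρ : ℝ) (hρ0 : 0 < ρ) (hρ : ρ * δ / 2 > 1 + δ) :
    ∃ C : ℝ, 0 < C ∧ ∃ N₀ : ℕ, ∀ N : ℕ, N₀ ≤ N →
      P (⋃ n ∈ {n : ℕ | N ≤ n}, (Dset q X ε n ∩ Eset q X ε n)ᶜ)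
        ≤ ENNReal.ofReal (C * (N : ℝ) ^ (-(min ε (δ/ρ)))) := by
  have hp0 : 0 < p := by linarith
  set a := Real.sqrt (q/p) with ha_def
  have hqp : 0 < q / p := by positivity
  have ha : 0 < a := Real.sqrt_pos.2 hqp
  have ha2 : a ^ 2 = q / p := Real.sq_sqrt hqp.le
  have hph : p * a^2 = q := by rw [ha2]; field_simp
  have ha1 : a < 1 := by
    have : q / p < 1 := by rw [div_lt_one hp0]; linarith
    nlinarith
  have hδ0 : 0 < δ := by
    have hlq := (Real.log_neg (by linarith : 0 < 2 * q) (by linarith))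
    have hθ1 : (2*q + a) / (1 + a) < 1 := by rw [div_lt_one (by positivity)]; linarith
    have hlθ := Real.log_neg (by positivity) hθ1
    have : 0 < 2 * Real.log ((2*q + a) / (1 + a)) / Real.log (2*q) := 
      div_pos_of_neg_of_neg (by linarith) hlq
    have h1 : 0 < 1 + δ := by linarith
    by_contra hneg
    nlinarith
  obtain ⟨hε0, hε1⟩ := hε
  have hη : 1 + δ/2 < (1 + δ) * (1 - ε) := by
    have : (1 - ε)^2 ≤ 1 - ε := by nlinarith
    nlinarith
  obtain ⟨n₀, hD⟩ := D_level ha ha1 hp0 hq0 hq hpq hph hX ε hε0 hε1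
  obtain ⟨C, hC, hE⟩ := E_level ha ha1 hp0 hq0 hq hpq hph hX hδ ε hε1 hη
  set s := min ε (δ/ρ) with hs
  have hs0 : 0 < s := lt_min hε0 (by positivity)
  have hsδ : s ≤ δ / 2 := by
    refine (min_le_right _ _).trans ?_
    apply div_le_div_of_nonneg_left hδ0.le (by norm_num)
    nlinarith
  have ht1 : (2:ℝ) ^ (-s) < 1 := Real.rpow_lt_one_of_one_lt_of_neg (by norm_num) (by linarith)
  have hC' : 0 < (1 + 1 / (2 * q) + C) := by positivity
  refine ⟨(1 + 1 / (2 * q) + C) * (1 - 2 ^ (-s))⁻¹, 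
    mul_pos hC' (inv_pos.2 (by linarith)), max n₀ 2, fun N hN => ?_⟩
  have hN2 : 2 ≤ N := (le_max_right _ _).trans hN
  refine dyadic_sum _ _ s hC' hs0 N (by omega) fun M hM => ?_
  have hM1 : (1:ℝ) ≤ M := by
    have : 1 ≤ M := by omega
    exact_mod_cast this
  have h1 := hD M ((le_max_left _ _).trans (hN.trans hM))
  have h2 := hE M (hN2.trans hM)
  have h3 : (M:ℝ) ^ (-ε) ≤ (M:ℝ) ^ (-s) := 
    Real.rpow_le_rpow_of_exponent_le hM1 (by linarith [min_le_left ε (δ/ρ)])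
  have h4 : (M:ℝ) ^ (-(δ/2)) ≤ (M:ℝ) ^ (-s) := 
    Real.rpow_le_rpow_of_exponent_le hM1 (by linarith)
  have hsub : (⋃ n ∈ Finset.Ico M (2*M), (Dset q X ε n ∩ Eset q X ε n)ᶜ) ⊆ 
      (⋃ n ∈ Finset.Ico M (2*M), (Dset q X ε n)ᶜ) ∪ (⋃ n ∈ Finset.Ico M (2*M), (Eset q X ε n)ᶜ) := by
    intro ω hω
    simp only [Set.mem_iUnion, Set.mem_union, Set.compl_inter] at hω ⊢
    obtain ⟨n, hn, h | h⟩ := hω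
    · exact Or.inl ⟨n, hn, h⟩
    · exact Or.inr ⟨n, hn, h⟩
  rw [← ofReal_measureReal (measure_ne_top _ _)]
  apply ENNReal.ofReal_le_ofReal
  refine (measureReal_mono hsub (measure_ne_top _ _)).trans ((measureReal_union_le _ _).trans ?_)
  calc _ ≤ (1 + 1 / (2 * q)) * (M:ℝ) ^ (-ε) + C * (M:ℝ) ^ (-(δ/2)) := add_le_add h1 h2
    _ ≤ (1 + 1 / (2 * q)) * (M:ℝ) ^ (-s) + C * (M:ℝ) ^ (-s) := by gcongr
    _ = _ := by ring
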